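/- The number of six-tuples (R^(1), R^(2), R^(3), R^(4), S^(3), S^(4)) of invertible 3×3 matrices over the field F_2 with two elements such that S^(3) ≠ R^(3), S^(4) ≠ R^(4), and all four direct-sum tetrahedron relations R^(1)_{123} R^(2)_{145} C_{246} D_{356} = D_{356} C_{246} R^(2)_{145} R^(1)_{123} hold for C ∈ {R^(3), S^(3)} and D ∈ {R^(4), S^(4)}, is exactly 3828292. -/

import Mathlib

open Matrix

/-- For a 3×3 matrix `R` over `F` and distinct indices `i j k : Fin 6`, the 6×6 matrix
which equals `R` on the rows and columns `i, j, k` and the identity elsewhere. -/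
def embed {F : Type*} [Zero F] [One F] (R : Matrix (Fin 3) (Fin 3) F)
    (i j k : Fin 6) : Matrix (Fin 6) (Fin 6) F := fun a b =>
  if a = i then (if b = i then R 0 0 else if b = j then R 0 1 else if b = k then R 0 2 else 0)
  else if a = j then (if b = i then R 1 0 else if b = j then R 1 1 else if b = k then R 1 2 else 0)
  else if a = k then (if b = i then R 2 0 else if b = j then R 2 1 else if b = k then R 2 2 else 0)
  else if a = b then 1 else 0

/-- The four direct-sum tetrahedron relations for a six-tuple
`(R1, R2, R3, R4, S3, S4)` of 3×3 matrices, with `C ∈ {R3, S3}` and `D ∈ {R4, S4}`. -/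
def FourRelations (R1 R2 R3 R4 S3 S4 : Matrix (Fin 3) (Fin 3) (ZMod 2)) : Prop :=
  (embed R1 0 1 2 * embed R2 0 3 4 * embed R3 1 3 5 * embed R4 2 4 5 =
     embed R4 2 4 5 * embed R3 1 3 5 * embed R2 0 3 4 * embed R1 0 1 2) ∧
  (embed R1 0 1 2 * embed R2 0 3 4 * embed R3 1 3 5 * embed S4 2 4 5 =
     embed S4 2 4 5 * embed R3 1 3 5 * embed R2 0 3 4 * embed R1 0 1 2) ∧
  (embed R1 0 1 2 * embed R2 0 3 4 * embed S3 1 3 5 * embed R4 2 4 5 =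
     embed R4 2 4 5 * embed S3 1 3 5 * embed R2 0 3 4 * embed R1 0 1 2) ∧
  (embed R1 0 1 2 * embed R2 0 3 4 * embed S3 1 3 5 * embed S4 2 4 5 =
     embed S4 2 4 5 * embed S3 1 3 5 * embed R2 0 3 4 * embed R1 0 1 2)

/-! ### The relation, entry by entry -/

def tet {F : Type*} [CommRing F] (A B C D : Matrix (Fin 3) (Fin 3) F) : Prop :=
  embed A 0 1 2 * embed B 0 3 4 * embed C 1 3 5 * embed D 2 4 5 =
    embed D 2 4 5 * embed C 1 3 5 * embed B 0 3 4 * embed A 0 1 2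

def linF {F : Type*} [CommRing F] (u0 u1 u2 x0 x1 x2 : F) : F := u0 * x0 + (u1 * x1 + u2 * x2)

def rowC {F : Type*} [CommRing F] (D : Matrix (Fin 3) (Fin 3) F) (u0 u1 u2 w0 w1 w2 : F) : Prop :=
  linF u0 u1 u2 (D 0 0) (D 1 0) (D 2 0) = w0 ∧ linF u0 u1 u2 (D 0 1) (D 1 1) (D 2 1) = w1 ∧
    linF u0 u1 u2 (D 0 2) (D 1 2) (D 2 2) = w2

def blockC {F : Type*} [CommRing F] (A B C : Matrix (Fin 3) (Fin 3) F) : Prop :=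
  A 0 1 * C 0 0 + A 0 0 * B 0 1 * C 1 0 = B 0 0 * A 0 1 ∧
  A 0 1 * C 0 1 + A 0 0 * B 0 1 * C 1 1 = B 0 1 ∧
  A 1 0 * B 0 0 = C 0 1 * B 1 0 * A 0 0 + C 0 0 * A 1 0 ∧
  A 1 0 * B 0 1 * C 1 0 = C 0 1 * B 1 0 * A 0 1 ∧
  A 1 1 * C 0 1 + A 1 0 * B 0 1 * C 1 1 = C 0 1 * B 1 1 ∧
  B 1 0 = C 1 1 * B 1 0 * A 0 0 + C 1 0 * A 1 0 ∧
  B 1 1 * C 1 0 = C 1 1 * B 1 0 * A 0 1 + C 1 0 * A 1 1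

def topC {F : Type*} [CommRing F] (A B C D : Matrix (Fin 3) (Fin 3) F) : Prop :=
  blockC A B C ∧
  rowC D (A 0 2) (A 0 0 * B 0 2) (A 0 1 * C 0 2 + A 0 0 * B 0 1 * C 1 2)
    (B 0 0 * A 0 2) (B 0 2) 0 ∧
  rowC D (A 1 2) (A 1 0 * B 0 2) (A 1 1 * C 0 2 + A 1 0 * B 0 1 * C 1 2)
    (C 0 1 * B 1 0 * A 0 2 + C 0 0 * A 1 2) (C 0 1 * B 1 2) (C 0 2) ∧
  rowC D 0 (B 1 2) (B 1 1 * C 1 2)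
    (C 1 1 * B 1 0 * A 0 2 + C 1 0 * A 1 2) (C 1 1 * B 1 2) (C 1 2)

def midC {F : Type*} [CommRing F] (D : Matrix (Fin 3) (Fin 3) F) (a b c y z p q r s : F) : Prop :=
  linF a y z (D 0 0) (D 1 0) (D 2 0) + linF a q r (D 0 0) (D 0 1) (D 0 2) = 0 ∧
  linF a y z (D 0 1) (D 1 1) (D 2 1) + linF 0 b s (D 0 0) (D 0 1) (D 0 2) = 0 ∧
  linF a y z (D 0 2) (D 1 2) (D 2 2) + linF 0 0 c (D 0 0) (D 0 1) (D 0 2) = 0 ∧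
  linF 0 b p (D 0 0) (D 1 0) (D 2 0) + linF a q r (D 1 0) (D 1 1) (D 1 2) = 0 ∧
  linF 0 b p (D 0 1) (D 1 1) (D 2 1) + linF 0 b s (D 1 0) (D 1 1) (D 1 2) = 0 ∧
  linF 0 b p (D 0 2) (D 1 2) (D 2 2) + linF 0 0 c (D 1 0) (D 1 1) (D 1 2) = 0 ∧
  linF 0 0 c (D 0 0) (D 1 0) (D 2 0) + linF a q r (D 2 0) (D 2 1) (D 2 2) = 0 ∧
  linF 0 0 c (D 0 1) (D 1 1) (D 2 1) + linF 0 b s (D 2 0) (D 2 1) (D 2 2) = 0 ∧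
  linF 0 0 c (D 0 2) (D 1 2) (D 2 2) + linF 0 0 c (D 2 0) (D 2 1) (D 2 2) = 0

def midM {F : Type*} [CommRing F] (A B C D : Matrix (Fin 3) (Fin 3) F) : Prop :=
  midC D (A 2 2) (B 2 2) (C 2 2) (A 2 0 * B 0 2) (A 2 1 * C 0 2 + A 2 0 * B 0 1 * C 1 2)
    (B 2 1 * C 1 2) (B 2 0 * A 0 2) (C 2 0 * A 1 2 + C 2 1 * B 1 0 * A 0 2) (C 2 1 * B 1 2)

theorem embed_012 {F : Type*} [CommRing F] (A : Matrix (Fin 3) (Fin 3) F) :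
    embed A 0 1 2 = !![A 0 0, A 0 1, A 0 2, 0, 0, 0; A 1 0, A 1 1, A 1 2, 0, 0, 0;
      A 2 0, A 2 1, A 2 2, 0, 0, 0; 0, 0, 0, 1, 0, 0; 0, 0, 0, 0, 1, 0; 0, 0, 0, 0, 0, 1] := by
  ext i j; fin_cases i <;> fin_cases j <;> rfl

theorem embed_034 {F : Type*} [CommRing F] (A : Matrix (Fin 3) (Fin 3) F) :
    embed A 0 3 4 = !![A 0 0, 0, 0, A 0 1, A 0 2, 0; 0, 1, 0, 0, 0, 0; 0, 0, 1, 0, 0, 0;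
      A 1 0, 0, 0, A 1 1, A 1 2, 0; A 2 0, 0, 0, A 2 1, A 2 2, 0; 0, 0, 0, 0, 0, 1] := by
  ext i j; fin_cases i <;> fin_cases j <;> rfl

theorem embed_135 {F : Type*} [CommRing F] (A : Matrix (Fin 3) (Fin 3) F) :
    embed A 1 3 5 = !![1, 0, 0, 0, 0, 0; 0, A 0 0, 0, A 0 1, 0, A 0 2; 0, 0, 1, 0, 0, 0;
      0, A 1 0, 0, A 1 1, 0, A 1 2; 0, 0, 0, 0, 1, 0; 0, A 2 0, 0, A 2 1, 0, A 2 2] := by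
  ext i j; fin_cases i <;> fin_cases j <;> rfl

theorem embed_245 {F : Type*} [CommRing F] (A : Matrix (Fin 3) (Fin 3) F) :
    embed A 2 4 5 = !![1, 0, 0, 0, 0, 0; 0, 1, 0, 0, 0, 0; 0, 0, A 0 0, 0, A 0 1, A 0 2;
      0, 0, 0, 1, 0, 0; 0, 0, A 1 0, 0, A 1 1, A 1 2; 0, 0, A 2 0, 0, A 2 1, A 2 2] := by
  ext i j; fin_cases i <;> fin_cases j <;> rfl

theorem two_zero (x : ZMod 2) : x + x = 0 := CharTwo.add_self_eq_zero x

set_option maxHeartbeats 2000000 in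
theorem tet_iff (A B C D : Matrix (Fin 3) (Fin 3) (ZMod 2)) :
    tet A B C D ↔ topC A B C D ∧ topC Aᵀ Bᵀ Cᵀ Dᵀ ∧ midM A B C D := by
  unfold tet
  rw [embed_012, embed_034, embed_135, embed_245, ← Matrix.ext_iff]
  simp [Fin.forall_fin_succ, topC, midM, blockC, rowC, midC, linF, CharTwo.add_eq_zero]
  constructor
  · rintro ⟨⟨h00, h01, h02, h03, h04, h05⟩, ⟨h10, h11, h12, h13, h14, h15⟩, ⟨h20, h21, h22, h23, h24, h25⟩, ⟨h30, h31, h32, h33, h34, h35⟩, ⟨h40, h41, h42, h43, h44, h45⟩, h50, h51, h52, h53, h54, h55⟩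
    refine ⟨⟨⟨?_, ?_, ?_, ?_, ?_, ?_, ?_⟩, ⟨?_, ?_, ?_⟩, ⟨?_, ?_, ?_⟩, ?_, ?_, ?_⟩, ⟨⟨?_, ?_, ?_, ?_, ?_, ?_, ?_⟩, ⟨?_, ?_, ?_⟩, ⟨?_, ?_, ?_⟩, ?_, ?_, ?_⟩, ?_, ?_, ?_, ?_, ?_, ?_, ?_, ?_⟩
    · linear_combination h01
    · linear_combination h03
    · linear_combination h10
    · linear_combination h11
    · linear_combination h13
    · linear_combination h30
    · linear_combination h31
    · linear_combination h02
    · linear_combination h04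
    · linear_combination h05
    · linear_combination h12
    · linear_combination h14
    · linear_combination h15
    · linear_combination h32
    · linear_combination h34
    · linear_combination h35
    · linear_combination -h10
    · linear_combination -h30
    · linear_combination -h01
    · linear_combination -h11
    · linear_combination -h31
    · linear_combination -h03
    · linear_combination -h13
    · linear_combination -h20
    · linear_combination -h40
    · rw [← CharTwo.add_eq_zero]; linear_combination -h50
    · linear_combination -h21
    · linear_combination -h41
    · linear_combination -h51
    · linear_combination -h23
    · linear_combination -h43
    · linear_combination -h53
    · linear_combination h22
    · linear_combination h24
    · linear_combination h25
    · linear_combination h42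
    · linear_combination h44
    · linear_combination h45
    · linear_combination h52
    · linear_combination h54
  · rintro ⟨⟨⟨h01, h03, h10, h11, h13, h30, h31⟩, ⟨h02, h04, h05⟩, ⟨h12, h14, h15⟩, h32, h34, h35⟩, ⟨⟨k10, k30, k01, k11, k31, k03, k13⟩, ⟨k20, k40, k50⟩, ⟨k21, k41, k51⟩, k23, k43, k53⟩, m22, m24, m25, m42, m44, m45, m52, m54⟩
    refine ⟨⟨?_, ?_, ?_, ?_, ?_, ?_⟩, ⟨?_, ?_, ?_, ?_, ?_, ?_⟩, ⟨?_, ?_, ?_, ?_, ?_, ?_⟩, ⟨?_, ?_, ?_, ?_, ?_, ?_⟩, ⟨?_, ?_, ?_, ?_, ?_, ?_⟩, ?_, ?_, ?_, ?_, ?_, ?_⟩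
    · ring
    · linear_combination h01
    · linear_combination h02
    · linear_combination h03
    · linear_combination h04
    · linear_combination h05
    · linear_combination h10
    · linear_combination h11
    · linear_combination h12
    · linear_combination h13
    · linear_combination h14
    · linear_combination h15
    · linear_combination -k20
    · linear_combination -k21
    · linear_combination m22
    · linear_combination -k23
    · linear_combination m24
    · linear_combination m25
    · linear_combination h30
    · linear_combination h31
    · linear_combination h32
    · ring
    · linear_combination h34
    · linear_combination h35
    · linear_combination -k40
    · linear_combination -k41
    · linear_combination m42
    · linear_combination -k43
    · linear_combination m44
    · linear_combination m45
    · linear_combination -(CharTwo.add_eq_zero.mpr k50)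
    · linear_combination -k51
    · linear_combination m52
    · linear_combination -k53
    · linear_combination m54
    · ring
def allD : Nat := 12347459532681866371650103205385203202014870699000085927504102630980511566271124405589336618481472192705632891054960030461063263236452902620175653666816
def tt00 : Nat := 8191574750570887666189263794038276567676107822640057063494905390500478168594086449946563634294138836468812454903831041731254373970762056769888552222720
def tt01 : Nat := 2512796136749299208864687630903321046975840713840314397272614926650735622832397430452857588360343305850454186143803287157447741398657224119588011114496
def tt02 : Nat := 9884406096335093576057185959672540846401991738897892158255738913007944169738297670311901500560155499235270013130040603158691425349032270081023635619840
def tt10 : Nat := 71926330432132890703691763655879590617946050340323267158239724039712122222863819632164988988081181309058366875664096252543485766537929927750167035904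
def tt11 : Nat := 12275216027719289436619762546702529507416735104840887491463898747492978947679833362467586998525082259365304660697402586836881550445724230865930984357888
def tt12 : Nat := 12347458284561944875127447506729592673346426210321719343468585242619903157943715377970183377751508609400286284473573168150465420462468464592982590357504
def tt20 : Nat := 12347459532681866201290749885252997805443699007421229178675095994629814052460941755002152519440690269465031417218851911284362307243498047416391344062464
def tt21 : Nat := 12347459532681866371650103205385203188072416983518668489542874833908307140261709004142336899931015509770085693801219500960013334449736075724651944214528
def tt22 : Nat := 12347459532681866371650103205385203202014870699000085927504102630980511566224722429962160994643229254684720295173183625931190319811225412921252730896384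
def grp : List (Nat × List Nat) :=
  [(10, [266, 330, 394, 458]),
   (11, [267, 331, 395, 459]),
   (12, [140, 204, 396, 460]),
   (13, [141, 205, 397, 461]),
   (14, [142, 206, 270, 334]),
   (15, [143, 207, 271, 335]),
   (17, [273, 337, 401, 465]),
   (19, [275, 339, 403, 467]),
   (20, [84, 212, 340, 468]),
   (21, [85, 213, 277, 405]),
   (22, [86, 214, 342, 470]),
   (23, [87, 215, 279, 407]),
   (25, [281, 345, 409, 473]),
   (26, [282, 346, 410, 474]),
   (28, [92, 156, 348, 412]),
   (29, [93, 157, 285, 477]),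
   (30, [94, 158, 286, 478]),
   (31, [95, 159, 351, 415]),
   (33, [161, 225, 417, 481]),
   (34, [98, 226, 354, 482]),
   (35, [99, 163, 355, 419]),
   (37, [165, 229, 421, 485]),
   (38, [102, 230, 358, 486]),
   (39, [103, 167, 359, 423]),
   (41, [169, 233, 425, 489]),
   (42, [106, 234, 298, 426]),
   (43, [107, 171, 299, 491]),
   (44, [172, 236, 428, 492]),
   (46, [110, 174, 302, 494]),
   (47, [111, 239, 303, 431]),
   (49, [177, 241, 305, 369]),
   (50, [114, 242, 370, 498]),
   (51, [115, 179, 307, 499]),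
   (52, [116, 244, 372, 500]),
   (53, [117, 181, 309, 501]),
   (55, [183, 247, 311, 375]),
   (57, [185, 249, 313, 377]),
   (58, [122, 250, 314, 442]),
   (59, [123, 187, 379, 443]),
   (60, [124, 188, 380, 444]),
   (61, [125, 253, 317, 445]),
   (62, [190, 254, 318, 382])]
/-! ### The computation -/

/-- Right fold through the raw recursor. -/
noncomputable def lrec {α β : Type} (f : α → β → β) (z : β) (l : List α) : β :=
  List.rec (motive := fun _ => β) z (fun a _ ih => f a ih) l

noncomputable def bforce {β : Type} (b : Bool) (f : Bool → β) : β :=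
  Bool.rec (motive := fun _ => β) (f false) (f true) b

noncomputable def nforce {β : Type} (n : Nat) (f : Nat → β) : β :=
  Nat.rec (motive := fun _ => β) (f 0) (fun k _ => f (Nat.add k 1)) n

noncomputable def bif' {β : Type} (b : Bool) (x y : β) : β :=
  Bool.rec (motive := fun _ => β) y x b

noncomputable def bx (a b : Bool) : Bool := bif' a (bif' b false true) b

noncomputable def ba (a b : Bool) : Bool := bif' a b false

noncomputable def bq (a b : Bool) : Bool := bif' a b (bif' b false true)

noncomputable def tb (n k : Nat) : Bool := Nat.beq (Nat.mod (Nat.shiftRight n k) 2) 1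

noncomputable def big (n : Nat) : Bool := bif' (Nat.beq (Nat.land n (Nat.pred n)) 0) false true

noncomputable def sel (b : Bool) (x : Nat) : Nat := bif' b x 0

/-- positions where `x` has truth value `w` -/
noncomputable def eqm (x : Nat) (w : Bool) : Nat := bif' w x (Nat.xor allD x)

/-- one entry of `u * D = w` -/
noncomputable def lin (u0 u1 u2 : Bool) (x0 x1 x2 : Nat) : Nat :=
  Nat.xor (sel u0 x0) (Nat.xor (sel u1 x1) (sel u2 x2))

/-- mask of the `D` with `u * D = w`; `tr` says to use the transpose of `D` -/
noncomputable def rowm (tr u0 u1 u2 w0 w1 w2 : Bool) : Nat :=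
  bif' tr
    (Nat.land (eqm (lin u0 u1 u2 tt00 tt01 tt02) w0)
      (Nat.land (eqm (lin u0 u1 u2 tt10 tt11 tt12) w1) (eqm (lin u0 u1 u2 tt20 tt21 tt22) w2)))
    (Nat.land (eqm (lin u0 u1 u2 tt00 tt10 tt20) w0)
      (Nat.land (eqm (lin u0 u1 u2 tt01 tt11 tt21) w1) (eqm (lin u0 u1 u2 tt02 tt12 tt22) w2)))

noncomputable def rowf (tr u0 u1 u2 w0 w1 w2 : Bool) : Nat :=
  bforce u0 fun u0 => bforce u1 fun u1 => bforce u2 fun u2 =>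
  bforce w0 fun w0 => bforce w1 fun w1 => bforce w2 fun w2 => rowm tr u0 u1 u2 w0 w1 w2

/-- the conditions not involving `D` -/
noncomputable def blockOK (a00 a01 a10 a11 b00 b01 b10 b11 c00 c01 c10 c11 : Bool) : Bool :=
  ba (bq (bx (ba a01 c00) (ba (ba a00 b01) c10)) (ba b00 a01)) <|
  ba (bq (bx (ba a01 c01) (ba (ba a00 b01) c11)) b01) <|
  ba (bq (ba a10 b00) (bx (ba (ba c01 b10) a00) (ba c00 a10))) <|
  ba (bq (ba (ba a10 b01) c10) (ba (ba c01 b10) a01)) <|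
  ba (bq (bx (ba a11 c01) (ba (ba a10 b01) c11)) (ba c01 b11)) <|
  ba (bq b10 (bx (ba (ba c11 b10) a00) (ba c10 a10))) <|
  bq (ba b11 c10) (bx (ba (ba c11 b10) a01) (ba c10 a11))

/-- the same conditions, from the codes -/
noncomputable def okN (a b c : Nat) : Bool :=
  blockOK (tb a 0) (tb a 1) (tb a 3) (tb a 4) (tb b 0) (tb b 1) (tb b 3) (tb b 4)
    (tb c 0) (tb c 1) (tb c 3) (tb c 4)

noncomputable def okF (a b c : Nat) : Bool :=
  nforce (Nat.land a 27) fun a => nforce (Nat.land b 27) fun b => nforce (Nat.land c 27) (okN a b)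

noncomputable def row0 (tr : Bool) (a b c : Nat) : Nat :=
  rowf tr (tb a 2) (ba (tb a 0) (tb b 2))
    (bx (ba (tb a 1) (tb c 2)) (ba (ba (tb a 0) (tb b 1)) (tb c 5)))
    (ba (tb b 0) (tb a 2)) (tb b 2) false

noncomputable def row1 (tr : Bool) (a b c : Nat) : Nat :=
  rowf tr (tb a 5) (ba (tb a 3) (tb b 2))
    (bx (ba (tb a 4) (tb c 2)) (ba (ba (tb a 3) (tb b 1)) (tb c 5)))
    (bx (ba (ba (tb c 1) (tb b 3)) (tb a 2)) (ba (tb c 0) (tb a 5)))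
    (ba (tb c 1) (tb b 5)) (tb c 2)

noncomputable def row3 (tr : Bool) (a b c : Nat) : Nat :=
  rowf tr false (tb b 5) (ba (tb b 4) (tb c 5))
    (bx (ba (ba (tb c 4) (tb b 3)) (tb a 2)) (ba (tb c 3) (tb a 5)))
    (ba (tb c 4) (tb b 5)) (tb c 5)

noncomputable def topN (tr : Bool) (a b c : Nat) : Nat :=
  bif' (okF a b c)
    (Nat.land (row0 tr a b c) (Nat.land (row1 tr a b c) (row3 tr a b c))) 0

/-- the equations `X_JJ D = D Y_JJ` -/
noncomputable def midB (a b c y z p q r s : Bool) : Nat :=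
  Nat.land (eqm (Nat.xor (lin a y z tt00 tt10 tt20) (lin a q r tt00 tt01 tt02)) false) <|
  Nat.land (eqm (Nat.xor (lin a y z tt01 tt11 tt21) (lin false b s tt00 tt01 tt02)) false) <|
  Nat.land (eqm (Nat.xor (lin a y z tt02 tt12 tt22) (lin false false c tt00 tt01 tt02)) false) <|
  Nat.land (eqm (Nat.xor (lin false b p tt00 tt10 tt20) (lin a q r tt10 tt11 tt12)) false) <|
  Nat.land (eqm (Nat.xor (lin false b p tt01 tt11 tt21) (lin false b s tt10 tt11 tt12)) false) <|
  Nat.land (eqm (Nat.xor (lin false b p tt02 tt12 tt22) (lin false false c tt10 tt11 tt12)) false) <|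
  Nat.land (eqm (Nat.xor (lin false false c tt00 tt10 tt20) (lin a q r tt20 tt21 tt22)) false) <|
  Nat.land (eqm (Nat.xor (lin false false c tt01 tt11 tt21) (lin false b s tt20 tt21 tt22)) false) <|
  eqm (Nat.xor (lin false false c tt02 tt12 tt22) (lin false false c tt20 tt21 tt22)) false

noncomputable def midN (a b c : Nat) : Nat :=
  bforce (tb a 8) fun a22 => bforce (tb b 8) fun b22 => bforce (tb c 8) fun c22 =>
  bforce (ba (tb a 6) (tb b 2)) fun y =>
  bforce (bx (ba (tb a 7) (tb c 2)) (ba (ba (tb a 6) (tb b 1)) (tb c 5))) fun z =>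
  bforce (ba (tb b 7) (tb c 5)) fun p =>
  bforce (ba (tb b 6) (tb a 2)) fun q =>
  bforce (bx (ba (tb c 6) (tb a 5)) (ba (ba (tb c 7) (tb b 3)) (tb a 2))) fun r =>
  bforce (ba (tb c 7) (tb b 5)) fun s =>
  midB a22 b22 c22 y z p q r s

noncomputable def popc (n : Nat) : Nat :=
  lrec (fun t k => lrec (fun x k => bif' (tb n x) (Nat.succ k) k) k t.2) 0 grp

noncomputable def kk (n : Nat) : Nat := Nat.mul (popc n) (Nat.pred (popc n))

noncomputable def psum (l : List Nat) : Nat :=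
  List.rec (motive := fun _ => Nat) 0
    (fun m l ih => Nat.add (lrec (fun m' s => Nat.add (nforce (Nat.land m m') kk) s) 0 l) ih) l

noncomputable def leftc (x : Nat) : Nat :=
  Nat.add (sel (tb x 0) 1) <| Nat.add (sel (tb x 3) 2) <| Nat.add (sel (tb x 6) 4) <|
  Nat.add (sel (tb x 1) 8) <| Nat.add (sel (tb x 4) 16) (sel (tb x 7) 32)

/-- one candidate `C`, full code `c`; `m` is the mask so far -/
noncomputable def step2 (acc : List Nat) (m : Nat) : List Nat := bif' (big m) (m :: acc) acc

noncomputable def step1 (a b c : Nat) (acc : List Nat) (m : Nat) : List Nat :=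
  bif' (big m) (nforce (Nat.land m (midN a b c)) (step2 acc)) acc

noncomputable def step0 (a b c : Nat) (acc : List Nat) (tm al bl cl : Nat) : List Nat :=
  nforce (Nat.land tm (topN true al bl cl)) (step1 a b c acc)

noncomputable def stepC (a b al bl tm : Nat) (c : Nat) (acc : List Nat) : List Nat :=
  nforce (leftc c) (step0 a b c acc tm al bl)

noncomputable def stepT (a b al bl : Nat) (t : Nat × List Nat) (acc : List Nat) : List Nat :=
  lrec (stepC a b al bl t.1) acc t.2

/-- masks with at least two elements, for given `A`, `B` -/
noncomputable def collect (Lt : List (Nat × List Nat)) (a b al bl : Nat) : List Nat :=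
  lrec (stepT a b al bl) [] Lt

noncomputable def filtS (t : Nat × List Nat) (acc : List (Nat × List Nat)) (m : Nat) :
    List (Nat × List Nat) :=
  bif' (big m) ((m, t.2) :: acc) acc

noncomputable def filt (at' bt : Nat) (l : List (Nat × List Nat)) : List (Nat × List Nat) :=
  lrec (fun t acc => nforce (topN false at' bt t.1) (filtS t acc)) [] l

noncomputable def sumAB (Lt : List (Nat × List Nat)) (as bs : List Nat) : Nat :=
  lrec (fun a s => lrec (fun b s =>
    Nat.add (nforce (leftc a) fun al => nforce (leftc b) fun bl =>
      psum (collect Lt a b al bl)) s) s bs) 0 as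

noncomputable def totalOn (l : List (Nat × List Nat)) : Nat :=
  lrec (fun ta s => lrec (fun tb s =>
    Nat.add (sumAB (filt ta.1 tb.1 grp) ta.2 tb.2) s) s grp) 0 l

/-! ### Meaning of the computation -/

theorem lrec_eq {α β : Type} (f : α → β → β) (z : β) (l : List α) :
    lrec f z l = l.foldr f z := by
  induction l with
  | nil => rfl
  | cons a l ih => rw [List.foldr_cons, ← ih]; rfl

theorem bforce_eq {β : Type} (b : Bool) (f : Bool → β) : bforce b f = f b := by
  cases b <;> rfl

theorem nforce_eq {β : Type} (n : Nat) (f : Nat → β) : nforce n f = f n := by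
  cases n <;> rfl

theorem bif'_eq {β : Type} (b : Bool) (x y : β) : bif' b x y = if b = true then x else y := by
  cases b <;> rfl

theorem bx_eq (a b : Bool) : bx a b = xor a b := by cases a <;> cases b <;> rfl

theorem ba_eq (a b : Bool) : ba a b = (a && b) := by cases a <;> cases b <;> rfl

theorem bq_eq (a b : Bool) : bq a b = (a == b) := by cases a <;> cases b <;> rfl

theorem tb_eq (n k : Nat) : tb n k = n.testBit k := by
  rw [Nat.testBit_eq_decide_div_mod_eq, ← Nat.shiftRight_eq_div_pow, Bool.eq_iff_iff]
  simp only [tb, Nat.beq_eq, decide_eq_true_eq]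
  rfl

/-- The element of `F_2` with a given truth value. -/
def zb (b : Bool) : ZMod 2 := if b = true then 1 else 0

theorem zb_mul (a b : Bool) : zb a * zb b = zb (a && b) := by
  cases a <;> cases b <;> rfl

theorem zb_add (a b : Bool) : zb a + zb b = zb (xor a b) := by
  cases a <;> cases b <;> rfl

theorem zb_false : zb false = 0 := rfl

theorem zb_inj (a b : Bool) : zb a = zb b ↔ a = b := by
  cases a <;> cases b <;> decide

/-- The matrix with a given code. -/
noncomputable def Mx (n : Nat) : Matrix (Fin 3) (Fin 3) (ZMod 2) :=
  !![zb (tb n 0), zb (tb n 1), zb (tb n 2); zb (tb n 3), zb (tb n 4), zb (tb n 5);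
    zb (tb n 6), zb (tb n 7), zb (tb n 8)]

/-- The list of all codes of invertible matrices. -/
def codes : List Nat := grp.flatMap (fun t => t.2)

theorem tables : ∀ x ∈ codes, tb allD x = true ∧ tb tt00 x = tb x 0 ∧ tb tt01 x = tb x 1 ∧
    tb tt02 x = tb x 2 ∧ tb tt10 x = tb x 3 ∧ tb tt11 x = tb x 4 ∧ tb tt12 x = tb x 5 ∧
    tb tt20 x = tb x 6 ∧ tb tt21 x = tb x 7 ∧ tb tt22 x = tb x 8 := by
  decide +kernel

theorem tb_land (m n k : Nat) : tb (Nat.land m n) k = (tb m k && tb n k) := by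
  simp only [tb_eq]; exact Nat.testBit_and m n k

theorem tb_xor (m n k : Nat) : tb (Nat.xor m n) k = xor (tb m k) (tb n k) := by
  simp only [tb_eq]; exact Nat.testBit_xor m n k

theorem tb_zero (k : Nat) : tb 0 k = false := by
  simp [tb_eq]

theorem tb_sel (b : Bool) (m k : Nat) : tb (sel b m) k = (b && tb m k) := by
  cases b
  · exact tb_zero k
  · rfl

theorem tb_lin (u0 u1 u2 : Bool) (x0 x1 x2 k : Nat) : zb (tb (lin u0 u1 u2 x0 x1 x2) k) =
    linF (zb u0) (zb u1) (zb u2) (zb (tb x0 k)) (zb (tb x1 k)) (zb (tb x2 k)) := by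
  simp only [lin, linF, tb_xor, tb_sel, zb_mul, zb_add]

theorem eqm_eq (m : Nat) (w : Bool) : eqm m w = if w = true then m else Nat.xor allD m := by
  unfold eqm
  rw [bif'_eq]

theorem tb_eqm {x : Nat} (hx : x ∈ codes) (m : Nat) (w : Bool) :
    tb (eqm m w) x = true ↔ zb (tb m x) = zb w := by
  rw [zb_inj, eqm_eq]
  cases w
  · rw [if_neg Bool.false_ne_true, tb_xor, (tables x hx).1, Bool.true_xor, Bool.not_eq_true']
  · rw [if_pos rfl]

theorem tb_rowf {x : Nat} (hx : x ∈ codes) (tr u0 u1 u2 w0 w1 w2 : Bool) :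
    tb (rowf tr u0 u1 u2 w0 w1 w2) x = true ↔
      rowC (if tr = true then (Mx x)ᵀ else Mx x) (zb u0) (zb u1) (zb u2) (zb w0) (zb w1) (zb w2) := by
  obtain ⟨-, h0, h1, h2, h3, h4, h5, h6, h7, h8⟩ := tables x hx
  cases tr <;>
  simp only [rowf, bforce_eq, rowm, bif'_eq, if_true, if_false, Bool.false_eq_true, tb_land,
    Bool.and_eq_true, tb_eqm hx, tb_lin, h0, h1, h2, h3, h4, h5, h6, h7, h8] <;>
  simp [rowC, Mx]

theorem okF_eq (a b c : Nat) : okF a b c = true ↔ blockC (Mx a) (Mx b) (Mx c) := by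
  have h : ∀ n : Nat, tb (Nat.land n 27) 0 = tb n 0 ∧ tb (Nat.land n 27) 1 = tb n 1 ∧
      tb (Nat.land n 27) 3 = tb n 3 ∧ tb (Nat.land n 27) 4 = tb n 4 := by
    intro n
    simp only [tb_land]
    refine ⟨?_, ?_, ?_, ?_⟩ <;> simp [show tb 27 0 = true by decide, show tb 27 1 = true by decide,
      show tb 27 3 = true by decide, show tb 27 4 = true by decide]
  simp only [okF, nforce_eq, okN, h, blockOK, blockC, Mx, ba_eq, bq_eq, bx_eq]
  simp [zb_mul, zb_add, zb_inj]

theorem tb_topN {x : Nat} (hx : x ∈ codes) (tr : Bool) (a b c : Nat) :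
    tb (topN tr a b c) x = true ↔
      topC (Mx a) (Mx b) (Mx c) (if tr = true then (Mx x)ᵀ else Mx x) := by
  unfold topN topC
  rw [← okF_eq]
  by_cases h : okF a b c = true
  · simp only [h, bif'_eq, if_true, tb_land, row0, row1, row3, Bool.and_eq_true, tb_rowf hx,
      true_and, ba_eq, bx_eq]
    simp only [← zb_mul, ← zb_add, zb_false]
    simp [Mx]
  · simp [h, bif'_eq, tb_zero]

theorem tb_midN {x : Nat} (hx : x ∈ codes) (a b c : Nat) :
    tb (midN a b c) x = true ↔ midM (Mx a) (Mx b) (Mx c) (Mx x) := by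
  obtain ⟨-, h0, h1, h2, h3, h4, h5, h6, h7, h8⟩ := tables x hx
  simp only [midN, bforce_eq, midB, tb_land, Bool.and_eq_true, tb_eqm hx, tb_xor, ← zb_add, tb_lin,
    h0, h1, h2, h3, h4, h5, h6, h7, h8, ba_eq, bx_eq, ← zb_mul, zb_false]
  simp [midM, midC, Mx]

theorem tb_leftc (a : Nat) : tb (leftc a) 0 = tb a 0 ∧ tb (leftc a) 1 = tb a 3 ∧
    tb (leftc a) 2 = tb a 6 ∧ tb (leftc a) 3 = tb a 1 ∧ tb (leftc a) 4 = tb a 4 ∧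
    tb (leftc a) 5 = tb a 7 := by
  unfold leftc
  generalize tb a 0 = x0
  generalize tb a 3 = x1
  generalize tb a 6 = x2
  generalize tb a 1 = x3
  generalize tb a 4 = x4
  generalize tb a 7 = x5
  revert x0 x1 x2 x3 x4 x5
  decide +kernel

theorem topC_congr {F : Type*} [CommRing F] {A B C A' B' C' D : Matrix (Fin 3) (Fin 3) F}
    (hA : ∀ j, A 0 j = A' 0 j ∧ A 1 j = A' 1 j) (hB : ∀ j, B 0 j = B' 0 j ∧ B 1 j = B' 1 j)
    (hC : ∀ j, C 0 j = C' 0 j ∧ C 1 j = C' 1 j) : topC A B C D ↔ topC A' B' C' D := by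
  simp only [topC, blockC, (hA _).1, (hA _).2, (hB _).1, (hB _).2, (hC _).1, (hC _).2]

theorem Mx_leftc (a : Nat) : ∀ j, Mx (leftc a) 0 j = (Mx a)ᵀ 0 j ∧ Mx (leftc a) 1 j = (Mx a)ᵀ 1 j := by
  obtain ⟨h0, h1, h2, h3, h4, h5⟩ := tb_leftc a
  intro j
  fin_cases j <;> simp [Mx, h0, h1, h2, h3, h4, h5]

theorem Mx_mod (a : Nat) : ∀ j, Mx (a % 64) 0 j = Mx a 0 j ∧ Mx (a % 64) 1 j = Mx a 1 j := by
  have h : ∀ k < 6, tb (a % 64) k = tb a k := by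
    intro k hk
    rw [tb_eq, tb_eq, show (64 : Nat) = 2 ^ 6 by norm_num, Nat.testBit_mod_two_pow]
    simp [hk]
  intro j
  fin_cases j <;> simp [Mx, h]

/-- The set of the `D` for given `A`, `B`, `C`, in the order in which it is computed. -/
noncomputable def mask (a b c : Nat) : Nat :=
  Nat.land (Nat.land (topN false (a % 64) (b % 64) (c % 64))
    (topN true (leftc a) (leftc b) (leftc c))) (midN a b c)

theorem tb_mask {x : Nat} (hx : x ∈ codes) (a b c : Nat) :
    tb (mask a b c) x = true ↔ tet (Mx a) (Mx b) (Mx c) (Mx x) := by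
  rw [tet_iff, mask, tb_land, tb_land, Bool.and_eq_true, Bool.and_eq_true, tb_topN hx, tb_topN hx,
    tb_midN hx, topC_congr (Mx_mod a) (Mx_mod b) (Mx_mod c),
    topC_congr (Mx_leftc a) (Mx_leftc b) (Mx_leftc c), and_assoc]
  simp

/-! ### Counting -/

theorem codes_nodup : codes.Nodup := by decide +kernel

theorem grp_mod : ∀ t ∈ grp, ∀ x ∈ t.2, t.1 = x % 64 := by decide +kernel

theorem foldr_flat {α β γ : Type} (f : α → List β) (g : β → γ → γ) (z : γ) (l : List α) :
    l.foldr (fun t k => (f t).foldr g k) z = (l.flatMap f).foldr g z := by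
  induction l with
  | nil => rfl
  | cons a l ih => simp [List.foldr_append, ih]

theorem popc_eq (n : Nat) : popc n = codes.countP (tb n) := by
  have h : ∀ l : List Nat, l.foldr (fun x k => bif' (tb n x) (Nat.succ k) k) 0 = l.countP (tb n) := by
    intro l
    induction l with
    | nil => rfl
    | cons a l ih =>
      rw [List.foldr_cons, ih, List.countP_cons, bif'_eq]
      by_cases h : tb n a = true <;> simp [h]
  simp only [popc, lrec_eq]
  rw [foldr_flat (fun t : Nat × List Nat => t.2), ← h]
  rfl

theorem popc_land (m n : Nat) : popc (Nat.land m n) ≤ popc m := by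
  rw [popc_eq, popc_eq]
  apply List.countP_mono_left
  intro x _ h
  rw [tb_land, Bool.and_eq_true] at h
  exact h.1

theorem land_pred {n i j : Nat} (hij : i < j) (hi : tb n i = true) (hj : tb n j = true) :
    Nat.land n (Nat.pred n) ≠ 0 := by
  intro h
  have h1 : tb (Nat.land n (Nat.pred n)) j = false := by rw [h, tb_zero]
  rw [tb_land, hj, Bool.true_and] at h1
  rw [tb_eq, Nat.testBit_eq_decide_div_mod_eq] at h1 hj hi
  have hr : n % 2 ^ j ≠ 0 := by
    intro h0
    obtain ⟨q, rfl⟩ := Nat.dvd_of_mod_eq_zero h0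
    obtain ⟨d, rfl⟩ : ∃ d, j = i + (d + 1) := ⟨j - i - 1, by omega⟩
    have : 2 ^ (i + (d + 1)) * q / 2 ^ i = 2 * (2 ^ d * q) := by
      rw [show 2 ^ (i + (d + 1)) * q = 2 ^ i * (2 * (2 ^ d * q)) by ring]
      exact Nat.mul_div_cancel_left _ (by positivity)
    rw [this] at hi
    simp at hi
  have hq : Nat.pred n / 2 ^ j = n / 2 ^ j := by
    have hp : 0 < 2 ^ j := by positivity
    have h2 := Nat.div_add_mod n (2 ^ j)
    have h3 := Nat.mod_lt n hp
    rw [Nat.div_eq_iff hp]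
    rw [Nat.pred_eq_sub_one]
    have h4 : 2 ^ j * (n / 2 ^ j) = n / 2 ^ j * 2 ^ j := Nat.mul_comm _ _
    constructor <;> omega
  rw [hq] at h1
  rw [hj] at h1
  exact absurd h1 (by decide)

theorem popc_of_not_big {n : Nat} (h : ¬ big n = true) : popc n ≤ 1 := by
  have h0 : Nat.land n (Nat.pred n) = 0 := by
    by_contra hne
    apply h
    simp only [big, bif'_eq, Nat.beq_eq, hne, if_false]
  rw [popc_eq, List.countP_eq_length_filter]
  have hnd : (codes.filter (tb n)).Nodup := codes_nodup.filter _
  by_contra hlt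
  push Not at hlt
  obtain ⟨x, hx, y, hy, hxy⟩ : ∃ x ∈ codes.filter (tb n), ∃ y ∈ codes.filter (tb n), x ≠ y := by
    match hl : codes.filter (tb n), hlt, hnd with
    | x :: y :: l, _, hnd =>
      refine ⟨x, by simp, y, by simp, ?_⟩
      rintro rfl
      simp at hnd
  have hx := (List.mem_filter.1 hx).2
  have hy := (List.mem_filter.1 hy).2
  rcases lt_or_gt_of_ne hxy with h | h
  · exact land_pred h hx hy h0
  · exact land_pred h hy hx h0

theorem kk_zero {n : Nat} (h : popc n ≤ 1) : kk n = 0 := by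
  unfold kk
  interval_cases popc n <;> rfl

theorem foldr_add {α : Type} (f : α → Nat) (z : Nat) (l : List α) :
    l.foldr (fun a s => Nat.add (f a) s) z = (l.map f).sum + z := by
  induction l with
  | nil => simp
  | cons a l ih => rw [List.foldr_cons, ih, List.map_cons, List.sum_cons, add_assoc]; rfl

theorem psum_cons (m : Nat) (l : List Nat) :
    psum (m :: l) = (l.map fun m' => kk (Nat.land m m')).sum + psum l := by
  have h := foldr_add (fun m' => kk (Nat.land m m')) 0 l
  rw [add_zero] at h
  rw [← h]
  change Nat.add (lrec (fun m' s => Nat.add (nforce (Nat.land m m') kk) s) 0 l) (psum l) = _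
  simp only [lrec_eq, nforce_eq]
  rfl

theorem psum_filter {α : Type} (keep : α → Bool) (f : α → Nat) (l : List α)
    (h : ∀ c, keep c = false → popc (f c) ≤ 1) :
    psum ((l.filter keep).map f) = psum (l.map f) := by
  have key : ∀ (m : Nat) (l : List α),
      (((l.filter keep).map f).map fun m' => kk (Nat.land m m')).sum =
        ((l.map f).map fun m' => kk (Nat.land m m')).sum := by
    intro m l
    induction l with
    | nil => rfl
    | cons c l ih =>
      by_cases hc : keep c = true
      · rw [List.filter_cons_of_pos hc]
        simp only [List.map_cons, List.sum_cons, ih]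
      · rw [List.filter_cons_of_neg hc]
        have : kk (Nat.land m (f c)) = 0 := by
          apply kk_zero
          have e : Nat.land m (f c) = Nat.land (f c) m := Nat.land_comm _ _
          rw [e]
          exact (popc_land _ _).trans (h c (by simpa using hc))
        simp only [List.map_cons, List.sum_cons, ih, this, zero_add]
  induction l with
  | nil => rfl
  | cons c l ih =>
    by_cases hc : keep c = true
    · rw [List.filter_cons_of_pos hc, List.map_cons, List.map_cons, psum_cons, psum_cons, ih, key]
    · rw [List.filter_cons_of_neg hc, List.map_cons, psum_cons, ih]
      have : ((l.map f).map fun m' => kk (Nat.land (f c) m')).sum = 0 := by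
        apply List.sum_eq_zero
        intro x hx
        obtain ⟨m', -, rfl⟩ := List.mem_map.1 hx
        exact kk_zero ((popc_land _ _).trans (h c (by simpa using hc)))
      rw [this, zero_add]

theorem two_psum (f : Nat → Nat) (l : List Nat) (hl : l.Nodup) :
    2 * psum (l.map f) = (l.map fun c => (l.map fun c' =>
      if c' = c then 0 else kk (Nat.land (f c) (f c'))).sum).sum := by
  induction l with
  | nil => rfl
  | cons c l ih =>
    rw [List.nodup_cons] at hl
    rw [List.map_cons, psum_cons, mul_add, ih hl.2]
    simp only [List.map_cons, List.sum_cons, if_true, zero_add, List.map_map]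
    rw [List.sum_map_add, ← add_assoc, two_mul]
    congr 1
    congr 1
    · congr 1
      apply List.map_congr_left
      intro x hx
      have : x ≠ c := fun h => hl.1 (h ▸ hx)
      simp [this]
    · congr 1
      apply List.map_congr_left
      intro x hx
      have : c ≠ x := fun h => hl.1 (h ▸ hx)
      have e : Nat.land (f x) (f c) = Nat.land (f c) (f x) := Nat.land_comm _ _
      simp only [this, if_false, e, Function.comp]


/-- The `C` kept by the search. -/
noncomputable def keep (a b c : Nat) : Bool :=
  big (topN false (a % 64) (b % 64) (c % 64)) &&
  (big (Nat.land (topN false (a % 64) (b % 64) (c % 64))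
    (topN true (leftc a) (leftc b) (leftc c))) && big (mask a b c))

theorem keep_false (a b c : Nat) (h : keep a b c = false) : popc (mask a b c) ≤ 1 := by
  unfold keep at h
  rw [Bool.and_eq_false_iff, Bool.and_eq_false_iff] at h
  rcases h with h | h | h
  · exact ((popc_land _ _).trans (popc_land _ _)).trans
      (popc_of_not_big (by rw [h]; exact Bool.false_ne_true))
  · exact (popc_land _ _).trans (popc_of_not_big (by rw [h]; exact Bool.false_ne_true))
  · exact popc_of_not_big (by rw [h]; exact Bool.false_ne_true)

theorem stepC_eq (a b c : Nat) (acc : List Nat)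
    (hb : big (topN false (a % 64) (b % 64) (c % 64)) = true) :
    stepC a b (leftc a) (leftc b) (topN false (a % 64) (b % 64) (c % 64)) c acc =
      if keep a b c = true then mask a b c :: acc else acc := by
  simp only [stepC, step0, step1, step2, nforce_eq, bif'_eq]
  by_cases h1 : big (Nat.land (topN false (a % 64) (b % 64) (c % 64))
      (topN true (leftc a) (leftc b) (leftc c))) = true
  · have hk : keep a b c = big (mask a b c) := by
      unfold keep
      rw [hb, h1, Bool.true_and, Bool.true_and]
    rw [if_pos h1, hk]
    rfl
  · have hk : ¬ keep a b c = true := by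
      unfold keep
      rw [Bool.and_eq_true, Bool.and_eq_true]
      exact fun h => h1 h.2.1
    rw [if_neg h1, if_neg hk]

theorem foldr_stepC (a b t1 : Nat) (acc t2 : List Nat) (ht : ∀ x ∈ t2, t1 = x % 64)
    (hb : big (topN false (a % 64) (b % 64) t1) = true) :
    t2.foldr (stepC a b (leftc a) (leftc b) (topN false (a % 64) (b % 64) t1)) acc =
      (t2.filter (keep a b)).map (mask a b) ++ acc := by
  induction t2 with
  | nil => rfl
  | cons c l ih =>
    have ih := ih (fun x hx => ht x (List.mem_cons_of_mem _ hx))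
    have hcm : t1 = c % 64 := ht c List.mem_cons_self
    rw [List.foldr_cons, ih]
    rw [hcm] at hb ⊢
    rw [stepC_eq a b c _ hb]
    by_cases hk : keep a b c = true
    · rw [if_pos hk, List.filter_cons_of_pos hk]; rfl
    · rw [if_neg hk, List.filter_cons_of_neg hk]

theorem collect_eq (a b : Nat) :
    collect (filt (a % 64) (b % 64) grp) a b (leftc a) (leftc b) =
      (codes.filter (keep a b)).map (mask a b) := by
  have main : ∀ g : List (Nat × List Nat), (∀ t ∈ g, ∀ x ∈ t.2, t.1 = x % 64) →
      collect (filt (a % 64) (b % 64) g) a b (leftc a) (leftc b) =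
        ((g.flatMap fun t => t.2).filter (keep a b)).map (mask a b) := by
    intro g hg
    induction g with
    | nil => rfl
    | cons t g ih =>
      have ih := ih (fun t ht => hg t (List.mem_cons_of_mem _ ht))
      have hc : filt (a % 64) (b % 64) (t :: g) =
          if big (topN false (a % 64) (b % 64) t.1) = true then
            (topN false (a % 64) (b % 64) t.1, t.2) :: filt (a % 64) (b % 64) g
          else filt (a % 64) (b % 64) g := by
        change nforce (topN false (a % 64) (b % 64) t.1) (filtS t (filt (a % 64) (b % 64) g)) = _
        rw [nforce_eq, filtS, bif'_eq]
      rw [hc, List.flatMap_cons, List.filter_append, List.map_append, ← ih]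
      have ht := hg t List.mem_cons_self
      generalize filt (a % 64) (b % 64) g = L
      obtain ⟨t1, t2⟩ := t
      by_cases hb : big (topN false (a % 64) (b % 64) t1) = true
      · rw [if_pos hb]
        change lrec (stepC a b (leftc a) (leftc b) (topN false (a % 64) (b % 64) t1))
          (collect L a b (leftc a) (leftc b)) t2 = _
        rw [lrec_eq]
        exact foldr_stepC a b t1 _ t2 ht hb
      · rw [if_neg hb]
        have : t2.filter (keep a b) = [] := by
          rw [List.filter_eq_nil_iff]
          intro x hx
          have hcm : t1 = x % 64 := ht x hx
          unfold keep
          rw [← hcm, Bool.and_eq_true]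
          exact fun h => hb h.1
        rw [this]; rfl
  exact main grp grp_mod

theorem foldr_add2 {α β : Type} (f : α → β → Nat) (z : Nat) (l : List α) (r : List β) :
    l.foldr (fun a s => r.foldr (fun b s => Nat.add (f a b) s) s) z =
      (l.map fun a => (r.map (f a)).sum).sum + z := by
  induction l with
  | nil => simp
  | cons a l ih => rw [List.foldr_cons, ih, foldr_add, List.map_cons, List.sum_cons, add_assoc]

theorem sum_swap {α : Type} (l : List α) (F : α → Nat → Nat) (g : List (Nat × List Nat)) :
    (g.map fun u => (l.map fun a => (u.2.map (F a)).sum).sum).sum =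
      (l.map fun a => ((g.flatMap fun u => u.2).map (F a)).sum).sum := by
  induction g with
  | nil => simp
  | cons u g ih =>
    rw [List.map_cons, List.sum_cons, ih, ← List.sum_map_add]
    simp only [List.flatMap_cons, List.map_append, List.sum_append]

/-- The contribution of a pair `(A, B)`. -/
noncomputable def pairC (a b : Nat) : Nat := psum (codes.map (mask a b))

theorem sumAB_eq (t u : Nat × List Nat) (ht : t ∈ grp) (hu : u ∈ grp) :
    sumAB (filt t.1 u.1 grp) t.2 u.2 = (t.2.map fun a => (u.2.map (pairC a)).sum).sum := by
  unfold sumAB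
  simp only [lrec_eq, nforce_eq]
  rw [foldr_add2 (fun a b => psum (collect (filt t.1 u.1 grp) a b (leftc a) (leftc b))), add_zero]
  refine congrArg List.sum (List.map_congr_left fun a ha => ?_)
  refine congrArg List.sum (List.map_congr_left fun b hb => ?_)
  rw [grp_mod t ht a ha, grp_mod u hu b hb, collect_eq, psum_filter _ _ _ (keep_false a b)]
  rfl

theorem totalOn_eq (l : List (Nat × List Nat)) (hl : ∀ t ∈ l, t ∈ grp) :
    totalOn l = ((l.flatMap fun t => t.2).map fun a => (codes.map (pairC a)).sum).sum := by
  unfold totalOn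
  simp only [lrec_eq]
  rw [foldr_add2 (fun t u : Nat × List Nat => sumAB (filt t.1 u.1 grp) t.2 u.2), add_zero]
  have h1 : ∀ t ∈ l, (grp.map fun u => sumAB (filt t.1 u.1 grp) t.2 u.2).sum =
      (t.2.map fun a => (codes.map (pairC a)).sum).sum := by
    intro t ht
    rw [List.map_congr_left fun u hu => sumAB_eq t u (hl t ht) hu]
    exact sum_swap t.2 pairC grp
  rw [List.map_congr_left h1]
  clear h1 hl
  induction l with
  | nil => rfl
  | cons t l ih =>
    rw [List.map_cons, List.sum_cons, ih, List.flatMap_cons, List.map_append, List.sum_append]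

theorem chunk0 : Nat.beq (totalOn ((grp.drop 0).take 7)) 1501104 = true := by decide +kernel
theorem chunk1 : Nat.beq (totalOn ((grp.drop 7).take 7)) 387298 = true := by decide +kernel
theorem chunk2 : Nat.beq (totalOn ((grp.drop 14).take 7)) 2696 = true := by decide +kernel
theorem chunk3 : Nat.beq (totalOn ((grp.drop 21).take 7)) 546 = true := by decide +kernel
theorem chunk4 : Nat.beq (totalOn ((grp.drop 28).take 7)) 14724 = true := by decide +kernel
theorem chunk5 : Nat.beq (totalOn ((grp.drop 35).take 7)) 7778 = true := by decide +kernel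


theorem grp_split : grp = (grp.drop 0).take 7 ++ ((grp.drop 7).take 7 ++ ((grp.drop 14).take 7 ++
    ((grp.drop 21).take 7 ++ ((grp.drop 28).take 7 ++ (grp.drop 35).take 7)))) := by
  decide +kernel

theorem chunk_eq {i v : Nat} (h : Nat.beq (totalOn ((grp.drop i).take 7)) v = true) :
    ((((grp.drop i).take 7).flatMap fun t => t.2).map fun a => (codes.map (pairC a)).sum).sum
      = v := by
  rw [← totalOn_eq _ fun t ht => List.mem_of_mem_drop (List.mem_of_mem_take ht)]
  exact Nat.eq_of_beq_eq_true h

theorem total_eq : (codes.map fun a => (codes.map (pairC a)).sum).sum = 1914146 := by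
  have h0 := chunk_eq chunk0
  have h1 := chunk_eq chunk1
  have h2 := chunk_eq chunk2
  have h3 := chunk_eq chunk3
  have h4 := chunk_eq chunk4
  have h5 := chunk_eq chunk5
  generalize hF : (fun a => (codes.map (pairC a)).sum) = F at *
  have h : codes = grp.flatMap fun t => t.2 := rfl
  rw [h, grp_split]
  simp only [List.flatMap_append, List.map_append, List.sum_append]
  rw [h0, h1, h2, h3, h4, h5]

/-! ### Matrices and their codes -/

/-- The number with given binary digits. -/
noncomputable def ofB (b0 b1 b2 b3 b4 b5 b6 b7 b8 : Bool) : Nat :=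
  Nat.add (sel b0 1) <| Nat.add (sel b1 2) <| Nat.add (sel b2 4) <| Nat.add (sel b3 8) <|
  Nat.add (sel b4 16) <| Nat.add (sel b5 32) <| Nat.add (sel b6 64) <| Nat.add (sel b7 128) <|
  sel b8 256

theorem tb_ofB : ∀ b0 b1 b2 b3 b4 b5 b6 b7 b8 : Bool,
    ofB b0 b1 b2 b3 b4 b5 b6 b7 b8 < 512 ∧
    tb (ofB b0 b1 b2 b3 b4 b5 b6 b7 b8) 0 = b0 ∧ tb (ofB b0 b1 b2 b3 b4 b5 b6 b7 b8) 1 = b1 ∧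
    tb (ofB b0 b1 b2 b3 b4 b5 b6 b7 b8) 2 = b2 ∧ tb (ofB b0 b1 b2 b3 b4 b5 b6 b7 b8) 3 = b3 ∧
    tb (ofB b0 b1 b2 b3 b4 b5 b6 b7 b8) 4 = b4 ∧ tb (ofB b0 b1 b2 b3 b4 b5 b6 b7 b8) 5 = b5 ∧
    tb (ofB b0 b1 b2 b3 b4 b5 b6 b7 b8) 6 = b6 ∧ tb (ofB b0 b1 b2 b3 b4 b5 b6 b7 b8) 7 = b7 ∧
    tb (ofB b0 b1 b2 b3 b4 b5 b6 b7 b8) 8 = b8 := by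
  decide +kernel

theorem exists_zb (x : ZMod 2) : ∃ b, zb b = x := by
  revert x
  decide

theorem exists_code (M : Matrix (Fin 3) (Fin 3) (ZMod 2)) : ∃ x < 512, Mx x = M := by
  choose b hb using fun i j => exists_zb (M i j)
  obtain ⟨h, h0, h1, h2, h3, h4, h5, h6, h7, h8⟩ :=
    tb_ofB (b 0 0) (b 0 1) (b 0 2) (b 1 0) (b 1 1) (b 1 2) (b 2 0) (b 2 1) (b 2 2)
  refine ⟨_, h, ?_⟩
  unfold Mx
  rw [h0, h1, h2, h3, h4, h5, h6, h7, h8]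
  simp only [hb]
  exact (Matrix.eta_fin_three M).symm

theorem Mx_inj {x y : Nat} (hx : x < 512) (hy : y < 512) (h : Mx x = Mx y) : x = y := by
  have e : ∀ i j, Mx x i j = Mx y i j := fun i j => by rw [h]
  have h0 := (zb_inj _ _).1 (e 0 0)
  have h1 := (zb_inj _ _).1 (e 0 1)
  have h2 := (zb_inj _ _).1 (e 0 2)
  have h3 := (zb_inj _ _).1 (e 1 0)
  have h4 := (zb_inj _ _).1 (e 1 1)
  have h5 := (zb_inj _ _).1 (e 1 2)
  have h6 := (zb_inj _ _).1 (e 2 0)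
  have h7 := (zb_inj _ _).1 (e 2 1)
  have h8 := (zb_inj _ _).1 (e 2 2)
  simp only [tb_eq] at h0 h1 h2 h3 h4 h5 h6 h7 h8
  apply Nat.eq_of_testBit_eq
  intro i
  rcases lt_or_ge i 9 with hi | hi
  · interval_cases i <;> assumption
  · have hp : 512 ≤ 2 ^ i := Nat.pow_le_pow_right (by norm_num : 0 < 2) hi
    rw [Nat.testBit_lt_two_pow (hx.trans_le hp), Nat.testBit_lt_two_pow (hy.trans_le hp)]

/-- The determinant of the matrix with code `x`. -/
noncomputable def detB (x : Nat) : Bool :=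
  xor (xor (xor (xor (xor (tb x 0 && tb x 4 && tb x 8) (tb x 0 && tb x 5 && tb x 7))
    (tb x 1 && tb x 3 && tb x 8)) (tb x 1 && tb x 5 && tb x 6))
    (tb x 2 && tb x 3 && tb x 7)) (tb x 2 && tb x 4 && tb x 6)

theorem codes_lt : ∀ x ∈ codes, x < 512 ∧ detB x = true := by decide +kernel

theorem mem_codes_aux :
    ((List.range 512).all fun x => (!detB x) || codes.any fun y => Nat.beq x y) = true := by
  decide +kernel

theorem mem_codes (x : Nat) (hx : x < 512) (h : detB x = true) : x ∈ codes := by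
  have h1 := List.all_eq_true.1 mem_codes_aux x (List.mem_range.2 hx)
  rw [h, Bool.not_true, Bool.false_or] at h1
  obtain ⟨y, hy, hxy⟩ := List.any_eq_true.1 h1
  rw [Nat.eq_of_beq_eq_true hxy]
  exact hy

theorem det_Mx (x : Nat) : (Mx x).det = zb (detB x) := by
  rw [Matrix.det_fin_three]
  simp only [CharTwo.sub_eq_add, detB, ← zb_add, ← zb_mul]
  rfl

theorem sum_GL (f : Matrix (Fin 3) (Fin 3) (ZMod 2) → Nat) :
    ∑ A : GL (Fin 3) (ZMod 2), f A = (codes.map fun x => f (Mx x)).sum := by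
  rw [← List.sum_toFinset _ codes_nodup]
  symm
  have hu : ∀ x ∈ codes.toFinset, IsUnit (Mx x) := by
    intro x hx
    rw [Matrix.isUnit_iff_isUnit_det, det_Mx, (codes_lt x (List.mem_toFinset.1 hx)).2]
    exact isUnit_one
  refine Finset.sum_bij (fun x hx => (hu x hx).unit) ?_ ?_ ?_ ?_
  · intro x hx
    exact @Finset.mem_univ _ _ _
  · intro x hx y hy h
    have h' : Mx x = Mx y := congrArg Units.val h
    exact Mx_inj (codes_lt x (List.mem_toFinset.1 hx)).1 (codes_lt y (List.mem_toFinset.1 hy)).1 h'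
  · intro A _
    obtain ⟨x, hx, hA⟩ := exists_code A
    have hd : detB x = true := by
      by_contra hne
      have h1 : IsUnit (Mx x).det := by
        rw [← Matrix.isUnit_iff_isUnit_det, hA]
        exact A.isUnit
      rw [det_Mx, Bool.eq_false_iff.2 hne, zb_false] at h1
      exact not_isUnit_zero h1
    refine ⟨x, List.mem_toFinset.2 (mem_codes x hx hd), ?_⟩
    exact Units.ext hA
  · intro x hx
    rfl

theorem sum_ite_countP {α : Type} (p : α → Prop) [DecidablePred p] (q : α → Bool) (l : List α)
    (h : ∀ x ∈ l, q x = true ↔ p x) : (l.map fun x => if p x then 1 else 0).sum = l.countP q := by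
  induction l with
  | nil => rfl
  | cons a l ih =>
    rw [List.map_cons, List.sum_cons, ih fun x hx => h x (List.mem_cons_of_mem _ hx),
      List.countP_cons, add_comm]
    congr 1
    have := h a List.mem_cons_self
    by_cases hp : p a
    · rw [if_pos hp, if_pos (this.2 hp)]
    · rw [if_neg hp, if_neg fun hq => hp (this.1 hq)]

open Classical in
theorem pairs {α : Type} [Fintype α] (P : α → Prop) :
    (∑ D : α, ∑ D' : α, if D' ≠ D ∧ P D ∧ P D' then 1 else 0) =
      (∑ D : α, if P D then 1 else 0) * Nat.pred (∑ D : α, if P D then 1 else 0) := by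
  have hk : (∑ D : α, if P D then 1 else 0) = (Finset.univ.filter P).card := by
    rw [Finset.card_filter]
  rw [hk, ← smul_eq_mul, ← Finset.sum_const, Finset.sum_filter]
  apply Finset.sum_congr rfl
  intro D _
  by_cases hD : P D
  · rw [if_pos hD, Nat.pred_eq_sub_one, ← Finset.card_erase_of_mem (a := D) (by simp [hD]),
      ← Finset.card_filter]
    congr 1
    ext x
    simp [hD]
  · simp [hD]

/-- `D` is compatible with both of the given `C`. -/
def good (a b c c' : Nat) (D : Matrix (Fin 3) (Fin 3) (ZMod 2)) : Prop :=
  tet (Mx a) (Mx b) (Mx c) D ∧ tet (Mx a) (Mx b) (Mx c') D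

open Classical in
theorem sum_good (a b c c' : Nat) :
    (∑ D : GL (Fin 3) (ZMod 2), if good a b c c' D then 1 else 0) =
      popc (Nat.land (mask a b c) (mask a b c')) := by
  rw [sum_GL (fun D => if good a b c c' D then 1 else 0), popc_eq]
  apply sum_ite_countP
  intro x hx
  rw [tb_land, Bool.and_eq_true, tb_mask hx, tb_mask hx]
  exact Iff.rfl

open Classical in
theorem innerDD_sum (a b c c' : Nat) :
    (∑ D : GL (Fin 3) (ZMod 2), ∑ D' : GL (Fin 3) (ZMod 2),
      if D' ≠ D ∧ good a b c c' D ∧ good a b c c' D' then 1 else 0) =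
      kk (Nat.land (mask a b c) (mask a b c')) := by
  have h := pairs (fun D : GL (Fin 3) (ZMod 2) => good a b c c' D)
  rw [sum_good] at h
  unfold kk
  refine Eq.trans ?_ h
  refine Finset.sum_congr rfl fun D _ => Finset.sum_congr rfl fun D' _ => ?_
  by_cases hh : D' ≠ D ∧ good a b c c' D ∧ good a b c c' D'
  · rw [if_pos hh, if_pos hh]
  · rw [if_neg hh, if_neg hh]

open Classical in
/-- The number of pairs of matrices in the fourth place, for given matrices in the other places. -/
noncomputable def cnt (A B C C' : Matrix (Fin 3) (Fin 3) (ZMod 2)) : Nat :=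
  ∑ D : GL (Fin 3) (ZMod 2), ∑ D' : GL (Fin 3) (ZMod 2),
    if C' ≠ C ∧ (D' : Matrix (Fin 3) (Fin 3) (ZMod 2)) ≠ D ∧ FourRelations A B C D C' D'
      then 1 else 0

theorem cnt_eq {a b c c' : Nat} (hc : c ∈ codes) (hc' : c' ∈ codes) :
    cnt (Mx a) (Mx b) (Mx c) (Mx c') =
      if c' = c then 0 else kk (Nat.land (mask a b c) (mask a b c')) := by
  classical
  unfold cnt
  by_cases h : c' = c
  · subst h
    simp
  · have hne : Mx c' ≠ Mx c := fun e => h (Mx_inj (codes_lt c' hc').1 (codes_lt c hc).1 e)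
    rw [if_neg h, ← innerDD_sum]
    refine Finset.sum_congr rfl fun D _ => Finset.sum_congr rfl fun D' _ => ?_
    have hD : (D' : Matrix (Fin 3) (Fin 3) (ZMod 2)) ≠ D ↔ D' ≠ D := Units.val_injective.ne_iff
    have hh : (Mx c' ≠ Mx c ∧ (D' : Matrix (Fin 3) (Fin 3) (ZMod 2)) ≠ D ∧
        FourRelations (Mx a) (Mx b) (Mx c) D (Mx c') D') ↔
        (D' ≠ D ∧ good a b c c' D ∧ good a b c c' D') := by
      rw [hD]
      exact ⟨fun ⟨_, h1, h2, h3, h4, h5⟩ => ⟨h1, ⟨h2, h4⟩, ⟨h3, h5⟩⟩,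
        fun ⟨h1, ⟨h2, h4⟩, ⟨h3, h5⟩⟩ => ⟨hne, h1, h2, h3, h4, h5⟩⟩
    by_cases hg : D' ≠ D ∧ good a b c c' D ∧ good a b c c' D'
    · rw [if_pos hg, if_pos (hh.2 hg)]
    · rw [if_neg hg, if_neg fun h => hg (hh.1 h)]

theorem sum_two (l : List Nat) (f : Nat → Nat) :
    (l.map fun x => 2 * f x).sum = 2 * (l.map f).sum := by
  induction l with
  | nil => rfl
  | cons a l ih =>
    rw [List.map_cons, List.sum_cons, ih, List.map_cons, List.sum_cons, Nat.mul_add]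

theorem sum_map_eq (l : List Nat) {f g : Nat → Nat} (h : ∀ x ∈ l, f x = g x) :
    (l.map f).sum = (l.map g).sum := by
  rw [List.map_congr_left h]

theorem double_eq {s T : Nat} (h : s = 2 * T) (hT : T = 1914146) : s = 3828292 := by
  rw [h, hT]

theorem sum_cnt_ab (a b : Nat) : (∑ C : GL (Fin 3) (ZMod 2), ∑ C' : GL (Fin 3) (ZMod 2),
    cnt (Mx a) (Mx b) C C') = 2 * pairC a b := by
  unfold pairC
  rw [two_psum _ _ codes_nodup, sum_GL (fun C => ∑ C' : GL (Fin 3) (ZMod 2),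
    cnt (Mx a) (Mx b) C C')]
  apply sum_map_eq
  intro c hc
  rw [sum_GL (fun C' => cnt (Mx a) (Mx b) (Mx c) C')]
  apply sum_map_eq
  intro c' hc'
  exact cnt_eq hc hc'

theorem sum_cnt_a (a : Nat) : (∑ B : GL (Fin 3) (ZMod 2), ∑ C : GL (Fin 3) (ZMod 2),
    ∑ C' : GL (Fin 3) (ZMod 2), cnt (Mx a) B C C') = 2 * (codes.map (pairC a)).sum :=
  ((sum_GL (fun B => ∑ C : GL (Fin 3) (ZMod 2), ∑ C' : GL (Fin 3) (ZMod 2),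
    cnt (Mx a) B C C')).trans (sum_map_eq codes fun b _ => sum_cnt_ab a b)).trans
    (sum_two codes (pairC a))

theorem sum_cnt_all : (∑ A : GL (Fin 3) (ZMod 2), ∑ B : GL (Fin 3) (ZMod 2),
    ∑ C : GL (Fin 3) (ZMod 2), ∑ C' : GL (Fin 3) (ZMod 2), cnt A B C C') =
      2 * (codes.map fun a => (codes.map (pairC a)).sum).sum :=
  ((sum_GL (fun A => ∑ B : GL (Fin 3) (ZMod 2), ∑ C : GL (Fin 3) (ZMod 2),
    ∑ C' : GL (Fin 3) (ZMod 2), cnt A B C C')).trans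
    (sum_map_eq codes fun a _ => sum_cnt_a a)).trans
    (sum_two codes fun a => (codes.map (pairC a)).sum)

theorem sum_cnt : (∑ A : GL (Fin 3) (ZMod 2), ∑ B : GL (Fin 3) (ZMod 2),
    ∑ C : GL (Fin 3) (ZMod 2), ∑ C' : GL (Fin 3) (ZMod 2), cnt A B C C') = 3828292 :=
  double_eq sum_cnt_all total_eq

/-- There are exactly 3828292 six-tuples `(R1, R2, R3, R4, S3, S4)` of invertible 3×3
matrices over `𝔽₂` with `S3 ≠ R3`, `S4 ≠ R4`, satisfying all four direct-sum tetrahedron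
relations. -/
theorem count_six_tuples :
    Nat.card {t : GL (Fin 3) (ZMod 2) × GL (Fin 3) (ZMod 2) × GL (Fin 3) (ZMod 2) ×
        GL (Fin 3) (ZMod 2) × GL (Fin 3) (ZMod 2) × GL (Fin 3) (ZMod 2) //
      (t.2.2.2.2.1 : Matrix (Fin 3) (Fin 3) (ZMod 2)) ≠
          (t.2.2.1 : Matrix (Fin 3) (Fin 3) (ZMod 2)) ∧
      (t.2.2.2.2.2 : Matrix (Fin 3) (Fin 3) (ZMod 2)) ≠
          (t.2.2.2.1 : Matrix (Fin 3) (Fin 3) (ZMod 2)) ∧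
      FourRelations (t.1 : Matrix (Fin 3) (Fin 3) (ZMod 2))
        (t.2.1 : Matrix (Fin 3) (Fin 3) (ZMod 2))
        (t.2.2.1 : Matrix (Fin 3) (Fin 3) (ZMod 2))
        (t.2.2.2.1 : Matrix (Fin 3) (Fin 3) (ZMod 2))
        (t.2.2.2.2.1 : Matrix (Fin 3) (Fin 3) (ZMod 2))
        (t.2.2.2.2.2 : Matrix (Fin 3) (Fin 3) (ZMod 2))} = 3828292 := by
  classical
  rw [Nat.card_eq_fintype_card, Fintype.card_subtype, Finset.card_filter, ← sum_cnt]
  simp only [Fintype.sum_prod_type, cnt]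
  refine Finset.sum_congr rfl fun A _ => Finset.sum_congr rfl fun B _ =>
    Finset.sum_congr rfl fun C _ => ?_
  rw [Finset.sum_comm]
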